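/- Let H⁰ be a norm on ℝ^N, let κ_N be the Lebesgue volume of {x ∈ ℝ^N : H⁰(x) < 1}, and let 0 < l < L. Then ∫_{{x ∈ ℝ^N : l < H⁰(x) < L}} H⁰(x)^{-N} dx = N κ_N log(L/l). Consequently, the Finsler Moser function m_l(x), equal to (Nκ_N)^{-1/N}(log(L/l))^{(N-1)/N} for H⁰(x) ≤ l, equal to (Nκ_N)^{-1/N} log(L/H⁰(x)) / (log(L/l))^{1/N} for l ≤ H⁰(x) ≤ L, and equal to 0 for H⁰(x) ≥ L, is Lipschitz and satisfies ∫_{ℝ^N} H(∇m_l(x))^N dx = 1, where ∇m_l is the (almost everywhere defined) gradient of m_l and H is the norm whose dual norm is H⁰. -/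

import Mathlib

open MeasureTheory Filter Real Set
open scoped RealInnerProductSpace Topology NNReal

noncomputable section

abbrev Euc (N : ℕ) := EuclideanSpace ℝ (Fin N)

/-- `H` is a norm on `ℝ^N`: convex, nonnegative, vanishing exactly at `0`,
and absolutely homogeneous. -/
def IsFinslerNorm (N : ℕ) (H : Euc N → ℝ) : Prop :=
  ConvexOn ℝ Set.univ H ∧
  (∀ ξ, 0 ≤ H ξ) ∧
  (∀ ξ, H ξ = 0 ↔ ξ = 0) ∧
  (∀ (t : ℝ) (ξ : Euc N), H (t • ξ) = |t| * H ξ)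

/-- Regularity assumptions: `H ∈ C²(ℝ^N \ {0})`, `H^N ∈ C¹(ℝ^N)`, and the Hessian of
`H^N` is positive definite away from the origin. -/
def FinslerRegular (N : ℕ) (H : Euc N → ℝ) : Prop :=
  ContDiffOn ℝ 2 H {(0 : Euc N)}ᶜ ∧
  ContDiff ℝ 1 (fun ξ => H ξ ^ N) ∧
  ∀ ξ : Euc N, ξ ≠ 0 → ∀ v : Euc N, v ≠ 0 →
    0 < iteratedFDeriv ℝ 2 (fun ξ => H ξ ^ N) ξ ![v, v]

/-- The dual norm `H⁰(x) = sup_{ξ ≠ 0} ⟪x, ξ⟫ / H(ξ)`. -/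
def dualNorm {N : ℕ} (H : Euc N → ℝ) (x : Euc N) : ℝ :=
  sSup {r : ℝ | ∃ ξ : Euc N, ξ ≠ 0 ∧ r = ⟪x, ξ⟫ / H ξ}

/-- `κ_N`, the volume of the Wulff ball `{H⁰ < 1}`. -/
def wulffVol (N : ℕ) (H : Euc N → ℝ) : ℝ :=
  (volume {x : Euc N | dualNorm H x < 1}).toReal

/-- `β_N = N (N κ_N)^{1/(N-1)}`. -/
def betaN (N : ℕ) (H : Euc N → ℝ) : ℝ :=
  N * (N * wulffVol N H) ^ ((1 : ℝ) / ((N : ℝ) - 1))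

/-- `u` is a weak solution of `-Q_N u = g` on the open set `U`:
`∫_U H(∇u)^{N-1} ⟪∇H(∇u), ∇φ⟫ = ∫_U g φ` for all test functions `φ`. -/
def IsWeakSolution (N : ℕ) (H : Euc N → ℝ) (U : Set (Euc N)) (u g : Euc N → ℝ) : Prop :=
  ∀ φ : Euc N → ℝ, ContDiff ℝ (⊤ : ℕ∞) φ → HasCompactSupport φ → tsupport φ ⊆ U →
    (∫ x in U, H (gradient u x) ^ (N - 1) * ⟪gradient H (gradient u x), gradient φ x⟫)
      = ∫ x in U, g x * φ x

/-- `C_p`, the infimum of `∫_Ω H(∇u)^N` over test functions normalized in `L^{p+1}`. -/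
def energyInf (N : ℕ) (H : Euc N → ℝ) (Ω : Set (Euc N)) (p : ℝ) : ℝ :=
  sInf {c : ℝ | ∃ u : Euc N → ℝ, ContDiff ℝ (⊤ : ℕ∞) u ∧ HasCompactSupport u ∧
    tsupport u ⊆ Ω ∧ (∫ x in Ω, |u x| ^ (p + 1)) = 1 ∧
    c = ∫ x in Ω, H (gradient u x) ^ N}

/-- A least energy solution of the Finsler Lane–Emden problem on `Ω` with exponent `p`. -/
def IsLeastEnergySolution (N : ℕ) (H : Euc N → ℝ) (Ω : Set (Euc N)) (p : ℝ)
    (u : Euc N → ℝ) : Prop :=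
  ContDiffOn ℝ 1 u (closure Ω) ∧
  (∀ x ∈ Ω, 0 < u x) ∧
  (∀ x ∈ frontier Ω, u x = 0) ∧
  IsWeakSolution N H Ω u (fun x => u x ^ p) ∧
  (∫ x in Ω, H (gradient u x) ^ N)
    = energyInf N H Ω p * (∫ x in Ω, u x ^ (p + 1)) ^ ((N : ℝ) / (p + 1))

/-- The blow-up set of a sequence of functions `v n` on `Ω`. -/
def BlowUpSet {N : ℕ} (Ω : Set (Euc N)) (v : ℕ → Euc N → ℝ) : Set (Euc N) :=
  {x | x ∈ closure Ω ∧ ∃ σ : ℕ → ℕ, StrictMono σ ∧ ∃ xs : ℕ → Euc N,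
    (∀ n, xs n ∈ Ω) ∧ Tendsto xs atTop (𝓝 x) ∧
    Tendsto (fun n => v (σ n) (xs n)) atTop atTop}

/-- The Finsler Moser function. -/
def moserFn (N : ℕ) (H : Euc N → ℝ) (l L : ℝ) (x : Euc N) : ℝ :=
  if dualNorm H x ≤ l then
    (N * wulffVol N H) ^ (-(1 : ℝ) / N) * Real.log (L / l) ^ (((N : ℝ) - 1) / N)
  else if dualNorm H x ≤ L then
    (N * wulffVol N H) ^ (-(1 : ℝ) / N) * Real.log (L / dualNorm H x)
      / Real.log (L / l) ^ ((1 : ℝ) / N)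
  else 0

section CompSeminorm

open Module Measure

variable {E : Type*} [AddCommGroup E] [Module ℝ E] [FiniteDimensional ℝ E] [mE : MeasurableSpace E]
  [tE : TopologicalSpace E] [IsTopologicalAddGroup E] [BorelSpace E] [T2Space E]
  [ContinuousSMul ℝ E]

/-- Polar coordinates for a function of a definite seminorm `p`, against any Haar measure. -/
theorem integral_comp_seminorm [Nontrivial E] (μ : Measure E) [IsAddHaarMeasure μ]
    (p : Seminorm ℝ E) (hp : ∀ x, p x = 0 → x = 0) (f : ℝ → ℝ) :
    ∫ x, f (p x) ∂μ =
      finrank ℝ E • μ.real {x | p x < 1} • ∫ y in Ioi (0 : ℝ), y ^ (finrank ℝ E - 1) • f y := by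
  -- `F` is a copy of `E` normed by `p`
  let F : Type _ := E
  let q : AddGroupNorm F := ⟨⟨p, map_zero p, map_add_le_add p, map_neg_eq_map p⟩, hp⟩
  let : NormedAddCommGroup F := AddGroupNorm.toNormedAddCommGroup q
  let : NormedSpace ℝ F := { norm_smul_le := fun r x ↦ (map_smul_eq_mul p r x).le }
  let : TopologicalSpace F := UniformSpace.toTopologicalSpace
  let : MeasurableSpace F := borel F
  have : BorelSpace F := { measurable_eq := rfl }
  let φ := @LinearEquiv.toContinuousLinearEquiv ℝ _ E _ _ tE _ _ F _ _ _ _ _ _ _ _ _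
    (LinearEquiv.refl ℝ E : E ≃ₗ[ℝ] F)
  let ν : Measure F := @Measure.map E F mE _ φ μ
  have hball : ν.real (Metric.ball 0 1) = μ.real {x | p x < 1} := by
    rw [measureReal_def, measureReal_def, @Measure.map_apply E F mE _ μ φ _ _ measurableSet_ball]
    · congr!
      simp_rw [Metric.ball, dist_zero_right]
      rfl
    · refine @Continuous.measurable E F tE mE _ _ _ _ φ ?_
      exact @ContinuousLinearEquiv.continuous ℝ ℝ _ _ _ _ _ _ E tE _ F _ _ _ _ φ
  have key := integral_fun_norm_addHaar ν f
  rw [hball] at key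
  refine Eq.trans ?_ key
  let ψ := @Homeomorph.toMeasurableEquiv E F tE mE _ _ _ _
    (@ContinuousLinearEquiv.toHomeomorph ℝ ℝ _ _ _ _ _ _ E tE _ F _ _ _ _ φ)
  have : @MeasurePreserving E F mE _ ψ μ ν :=
    @Measurable.measurePreserving E F mE _ ψ (@MeasurableEquiv.measurable E F mE _ ψ) _
  rw [← this.integral_comp']
  rfl

theorem measure_seminorm_le_eq_lt [Nontrivial E] (μ : Measure E) [IsAddHaarMeasure μ]
    (p : Seminorm ℝ E) (hp : ∀ x, p x = 0 → x = 0) (r : ℝ) :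
    μ {x | p x ≤ r} = μ {x | p x < r} :=
  measure_le_eq_lt μ (map_zero p) (map_neg_eq_map p) (map_add_le_add p) (hp _)
    (fun r x ↦ (map_smul_eq_mul p r x).le) r

end CompSeminorm

section SeminormGradient

variable {E : Type*} [NormedAddCommGroup E] [InnerProductSpace ℝ E] [CompleteSpace E]

theorem HasGradientAt.hasDerivAt_line {f : E → ℝ} {v x : E} (h : HasGradientAt f v x) (y : E) :
    HasDerivAt (fun t : ℝ ↦ f (x + t • y)) ⟪v, y⟫ 0 := by
  simpa [HasLineDerivAt] using h.hasFDerivAt.hasLineDerivAt y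

theorem Seminorm.inner_gradient_le {p : Seminorm ℝ E} {v x : E} (h : HasGradientAt p v x) (y : E) :
    ⟪v, y⟫ ≤ p y := by
  refine le_of_tendsto (h.hasDerivAt_line y).tendsto_slope_zero_right ?_
  filter_upwards [self_mem_nhdsWithin] with t (ht : 0 < t)
  have h1 : p (x + t • y) ≤ p x + t * p y := by
    simpa [map_smul_eq_mul, abs_of_pos ht] using map_add_le_add p x (t • y)
  simp only [zero_add, zero_smul, add_zero, smul_eq_mul]
  rw [inv_mul_le_iff₀ ht]
  linarith

theorem Seminorm.inner_gradient_self {p : Seminorm ℝ E} {v x : E} (h : HasGradientAt p v x) :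
    ⟪v, x⟫ = p x := by
  refine (h.hasDerivAt_line x).unique ?_
  have h1 : HasDerivAt (fun t : ℝ ↦ (1 + t) * p x) (p x) 0 := by
    simpa using ((hasDerivAt_id (0 : ℝ)).const_add 1).mul_const (p x)
  refine h1.congr_of_eventuallyEq ?_
  filter_upwards [Ioi_mem_nhds (show (-1 : ℝ) < 0 by norm_num)] with t (ht : -1 < t)
  rw [show x + t • x = (1 + t) • x by rw [add_smul, one_smul], map_smul_eq_mul, Real.norm_eq_abs,
    abs_of_pos (by linarith)]

end SeminormGradient

section Finsler

variable {N : ℕ} {H : Euc N → ℝ}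

/-- A Finsler norm as a bundled seminorm. -/
def IsFinslerNorm.toSeminorm (h : IsFinslerNorm N H) : Seminorm ℝ (Euc N) :=
  Seminorm.of H (fun x y ↦ by
    have h1 := h.1.2 (mem_univ x) (mem_univ y) (show (0 : ℝ) ≤ 1 / 2 by norm_num)
      (show (0 : ℝ) ≤ 1 / 2 by norm_num) (by norm_num)
    rw [← smul_add, h.2.2.2, abs_of_pos (by norm_num : (0 : ℝ) < 1 / 2), smul_eq_mul,
      smul_eq_mul] at h1
    linarith) h.2.2.2

theorem IsFinslerNorm.pos (h : IsFinslerNorm N H) {ξ : Euc N} (hξ : ξ ≠ 0) : 0 < H ξ :=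
  (h.2.1 ξ).lt_of_ne fun h0 ↦ hξ ((h.2.2.1 ξ).1 h0.symm)

theorem IsFinslerNorm.zero (h : IsFinslerNorm N H) : H 0 = 0 := (h.2.2.1 0).2 rfl

theorem FinslerRegular.continuousOn_sphere (hreg : FinslerRegular N H) :
    ContinuousOn H (Metric.sphere 0 1) :=
  hreg.1.continuousOn.mono fun _ hx ↦ Metric.ne_of_mem_sphere hx one_ne_zero

theorem FinslerRegular.hasGradientAt (hreg : FinslerRegular N H) {ξ : Euc N} (hξ : ξ ≠ 0) :
    HasGradientAt H (gradient H ξ) ξ :=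
  ((hreg.1.differentiableOn (by norm_num)).differentiableAt
    (isOpen_compl_singleton.mem_nhds hξ)).hasGradientAt

theorem IsFinslerNorm.exists_norm_le_mul (h : IsFinslerNorm N H) (hreg : FinslerRegular N H) :
    ∃ C : ℝ≥0, ∀ ξ, ‖ξ‖ ≤ C * H ξ := by
  have hne : ∀ ξ ∈ Metric.sphere (0 : Euc N) 1, H ξ ≠ 0 := fun ξ hξ ↦
    (h.pos (Metric.ne_of_mem_sphere hξ one_ne_zero)).ne'
  obtain ⟨C, hC⟩ := (isCompact_sphere (0 : Euc N) 1).exists_bound_of_continuousOn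
    (hreg.continuousOn_sphere.inv₀ hne)
  refine ⟨C.toNNReal, fun ξ ↦ ?_⟩
  rcases eq_or_ne ξ 0 with rfl | hξ
  · simp [h.zero]
  have hn : 0 < ‖ξ‖ := norm_pos_iff.2 hξ
  have h1 := hC (‖ξ‖⁻¹ • ξ) (by simp [norm_smul, hn.ne'])
  rw [Pi.inv_apply, h.2.2.2, abs_of_pos (inv_pos.2 hn), mul_inv, inv_inv, Real.norm_eq_abs,
    abs_of_pos (mul_pos hn (inv_pos.2 (h.pos hξ))), ← div_eq_mul_inv, div_le_iff₀ (h.pos hξ)] at h1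
  exact h1.trans (mul_le_mul_of_nonneg_right (Real.le_coe_toNNReal C) (h.2.1 ξ))

theorem IsFinslerNorm.exists_le_mul_norm (h : IsFinslerNorm N H) (hreg : FinslerRegular N H) :
    ∃ C : ℝ, ∀ ξ, H ξ ≤ C * ‖ξ‖ := by
  obtain ⟨C, hC⟩ := (isCompact_sphere (0 : Euc N) 1).exists_bound_of_continuousOn
    hreg.continuousOn_sphere
  refine ⟨C, fun ξ ↦ ?_⟩
  rcases eq_or_ne ξ 0 with rfl | hξ
  · simp [h.zero]
  have hn : 0 < ‖ξ‖ := norm_pos_iff.2 hξ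
  have h1 := (le_abs_self _).trans (hC (‖ξ‖⁻¹ • ξ) (by simp [norm_smul, hn.ne']))
  rwa [h.2.2.2, abs_of_pos (inv_pos.2 hn), inv_mul_le_iff₀ hn, mul_comm] at h1

theorem inner_le_dualNorm_mul (h : IsFinslerNorm N H) (hreg : FinslerRegular N H) (x ξ : Euc N) :
    ⟪x, ξ⟫ ≤ dualNorm H x * H ξ := by
  rcases eq_or_ne ξ 0 with rfl | hξ
  · simp [h.zero]
  rw [← div_le_iff₀ (h.pos hξ)]
  obtain ⟨C, hC⟩ := h.exists_norm_le_mul hreg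
  refine le_csSup ⟨‖x‖ * C, ?_⟩ ⟨ξ, hξ, rfl⟩
  rintro _ ⟨η, hη, rfl⟩
  rw [div_le_iff₀ (h.pos hη), mul_assoc]
  exact (real_inner_le_norm x η).trans (mul_le_mul_of_nonneg_left (hC η) (norm_nonneg x))

theorem dualNorm_le (h : IsFinslerNorm N H) {x : Euc N} {a : ℝ} (ha : 0 ≤ a)
    (hx : ∀ ξ, ⟪x, ξ⟫ ≤ a * H ξ) : dualNorm H x ≤ a := by
  refine Real.sSup_le ?_ ha
  rintro _ ⟨ξ, hξ, rfl⟩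
  rw [div_le_iff₀ (h.pos hξ)]
  exact hx ξ

theorem dualNorm_zero : dualNorm H 0 = 0 := by
  refine le_antisymm (Real.sSup_nonpos ?_) (Real.sSup_nonneg ?_) <;>
  · rintro _ ⟨ξ, -, rfl⟩
    simp

theorem dualNorm_pos (h : IsFinslerNorm N H) (hreg : FinslerRegular N H) {x : Euc N}
    (hx : x ≠ 0) : 0 < dualNorm H x := by
  have h1 := inner_le_dualNorm_mul h hreg x x
  have h2 : 0 < ⟪x, x⟫ := real_inner_self_pos.2 hx
  exact pos_of_mul_pos_left (h2.trans_le h1) (h.2.1 x)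

theorem dualNorm_nonneg (h : IsFinslerNorm N H) (hreg : FinslerRegular N H) (x : Euc N) :
    0 ≤ dualNorm H x := by
  rcases eq_or_ne x 0 with rfl | hx
  · exact dualNorm_zero.ge
  · exact (dualNorm_pos h hreg hx).le

/-- The dual norm as a bundled seminorm. -/
def dualSeminorm (h : IsFinslerNorm N H) (hreg : FinslerRegular N H) : Seminorm ℝ (Euc N) :=
  Seminorm.ofSMulLE (dualNorm H) dualNorm_zero
    (fun x y ↦ dualNorm_le h
      (add_nonneg (dualNorm_nonneg h hreg x) (dualNorm_nonneg h hreg y)) fun ξ ↦ by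
        rw [inner_add_left, add_mul]
        exact add_le_add (inner_le_dualNorm_mul h hreg x ξ) (inner_le_dualNorm_mul h hreg y ξ))
    (fun t x ↦ dualNorm_le h (mul_nonneg (norm_nonneg t) (dualNorm_nonneg h hreg x)) fun ξ ↦ by
      have h1 := inner_le_dualNorm_mul h hreg x (t • ξ)
      rw [h.2.2.2, real_inner_smul_right] at h1
      rw [real_inner_smul_left, Real.norm_eq_abs]
      linarith)

theorem dualSeminorm_definite (h : IsFinslerNorm N H) (hreg : FinslerRegular N H) (x : Euc N)
    (hx : dualSeminorm h hreg x = 0) : x = 0 := by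
  by_contra hne
  exact (dualNorm_pos h hreg hne).ne' hx

theorem exists_lipschitzWith_dualNorm (h : IsFinslerNorm N H) (hreg : FinslerRegular N H) :
    ∃ K : ℝ≥0, LipschitzWith K (dualNorm H) := by
  obtain ⟨C, hC⟩ := h.exists_norm_le_mul hreg
  refine ⟨C, LipschitzWith.of_le_add_mul C fun x y ↦ ?_⟩
  have h1 : dualNorm H x ≤ dualNorm H y + dualNorm H (x - y) := by
    conv_lhs => rw [← add_sub_cancel y x]
    exact map_add_le_add (dualSeminorm h hreg) y (x - y)
  have h2 : dualNorm H (x - y) ≤ C * ‖x - y‖ := dualNorm_le h (by positivity) fun ξ ↦ by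
    refine (real_inner_le_norm _ ξ).trans ?_
    nlinarith [mul_le_mul_of_nonneg_left (hC ξ) (norm_nonneg (x - y))]
  rw [dist_eq_norm]
  linarith

theorem continuous_dualNorm (h : IsFinslerNorm N H) (hreg : FinslerRegular N H) :
    Continuous (dualNorm H) :=
  (exists_lipschitzWith_dualNorm h hreg).choose_spec.continuous

theorem exists_norm_le_mul_dualNorm (h : IsFinslerNorm N H) (hreg : FinslerRegular N H) :
    ∃ C : ℝ, ∀ x, ‖x‖ ≤ C * dualNorm H x := by
  obtain ⟨C, hC⟩ := h.exists_le_mul_norm hreg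
  refine ⟨C, fun x ↦ ?_⟩
  rcases eq_or_ne x 0 with rfl | hx
  · simp [dualNorm_zero]
  have h1 := inner_le_dualNorm_mul h hreg x x
  rw [real_inner_self_eq_norm_sq] at h1
  have h2 := mul_le_mul_of_nonneg_left (hC x) (dualNorm_nonneg h hreg x)
  have hn : 0 < ‖x‖ := norm_pos_iff.2 hx
  refine le_of_mul_le_mul_right ?_ hn
  nlinarith

theorem volume_dualNorm_le_lt_top (h : IsFinslerNorm N H) (hreg : FinslerRegular N H) (r : ℝ) :
    volume {x : Euc N | dualNorm H x ≤ r} < ⊤ := by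
  obtain ⟨C, hC⟩ := exists_norm_le_mul_dualNorm h hreg
  refine (measure_mono fun x (hx : dualNorm H x ≤ r) ↦ ?_).trans_lt
    (measure_closedBall_lt_top (x := (0 : Euc N)) (r := |C| * r))
  rw [mem_closedBall_zero_iff]
  have h0 := dualNorm_nonneg h hreg x
  calc ‖x‖ ≤ C * dualNorm H x := hC x
    _ ≤ |C| * dualNorm H x := mul_le_mul_of_nonneg_right (le_abs_self C) h0
    _ ≤ |C| * r := mul_le_mul_of_nonneg_left hx (abs_nonneg C)

theorem wulffVol_pos (h : IsFinslerNorm N H) (hreg : FinslerRegular N H) : 0 < wulffVol N H := by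
  refine ENNReal.toReal_pos ?_ ?_
  · exact ((isOpen_lt (continuous_dualNorm h hreg) continuous_const).measure_pos volume
      ⟨0, by simp [dualNorm_zero]⟩).ne'
  · exact ((measure_mono fun x (hx : dualNorm H x < 1) ↦ hx.le).trans_lt
      (volume_dualNorm_le_lt_top h hreg 1)).ne

theorem ae_dualNorm_ne [Nontrivial (Euc N)] (h : IsFinslerNorm N H) (hreg : FinslerRegular N H)
    (r : ℝ) : ∀ᵐ x : Euc N, dualNorm H x ≠ r := by
  have hcont := continuous_dualNorm h hreg
  have h1 : volume {x : Euc N | dualNorm H x ≤ r} = volume {x : Euc N | dualNorm H x < r} :=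
    measure_seminorm_le_eq_lt volume (dualSeminorm h hreg) (dualSeminorm_definite h hreg) r
  have h2 : {x : Euc N | dualNorm H x = r} =
      {x | dualNorm H x ≤ r} \ {x | dualNorm H x < r} := by
    ext x
    simp [le_antisymm_iff]
  rw [ae_iff]
  simp only [ne_eq, not_not]
  rw [h2, measure_sdiff (ofPred_subset_ofPred.2 fun x hx ↦ hx.le)
    (measurableSet_lt hcont.measurable measurable_const).nullMeasurableSet
    (h1 ▸ (volume_dualNorm_le_lt_top h hreg r).ne), h1, tsub_self]

/-- The gradient of the dual norm lies on the unit sphere of `H`. -/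
theorem apply_gradient_dualNorm (h : IsFinslerNorm N H) (hreg : FinslerRegular N H) {v x : Euc N}
    (hx : x ≠ 0) (hv : HasGradientAt (dualNorm H) v x) : H v = 1 := by
  have hv' : HasGradientAt (dualSeminorm h hreg) v x := hv
  have hpos := dualNorm_pos h hreg hx
  have hself : ⟪v, x⟫ = dualNorm H x := Seminorm.inner_gradient_self hv'
  have hge : 1 ≤ H v := by
    have h1 := inner_le_dualNorm_mul h hreg x v
    rw [real_inner_comm, hself] at h1
    exact le_of_mul_le_mul_left (by simpa using h1) hpos
  refine le_antisymm ?_ hge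
  have hv0 : v ≠ 0 := by
    rintro rfl
    rw [h.zero] at hge
    linarith
  have hw : HasGradientAt h.toSeminorm (gradient H v) v := hreg.hasGradientAt hv0
  have hdual : dualNorm H (gradient H v) ≤ 1 := dualNorm_le h zero_le_one fun ξ ↦ by
    rw [one_mul]
    exact Seminorm.inner_gradient_le hw ξ
  calc H v = ⟪gradient H v, v⟫ := (Seminorm.inner_gradient_self hw).symm
    _ = ⟪v, gradient H v⟫ := real_inner_comm _ _
    _ ≤ dualNorm H (gradient H v) := Seminorm.inner_gradient_le hv' _
    _ ≤ 1 := hdual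

theorem setIntegral_annulus_dualNorm (hN : N ≠ 0) (h : IsFinslerNorm N H)
    (hreg : FinslerRegular N H) {l L : ℝ} (hl : 0 < l) (hlL : l < L) :
    (∫ x in {x : Euc N | l < dualNorm H x ∧ dualNorm H x < L}, dualNorm H x ^ (-(N : ℝ)))
      = N * wulffVol N H * Real.log (L / l) := by
  have : NeZero N := ⟨hN⟩
  have hmeas : MeasurableSet {x : Euc N | l < dualNorm H x ∧ dualNorm H x < L} :=
    (continuous_dualNorm h hreg).measurable measurableSet_Ioo
  have h1 := integral_comp_seminorm volume (dualSeminorm h hreg) (dualSeminorm_definite h hreg)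
    ((Ioo l L).indicator fun y ↦ y ^ (-(N : ℝ)))
  have h2 : ∫ y in Ioi (0 : ℝ), y ^ (N - 1) • (Ioo l L).indicator (fun y ↦ y ^ (-(N : ℝ))) y
      = Real.log (L / l) := by
    rw [← integral_inv_of_pos hl (hl.trans hlL), intervalIntegral.integral_of_le hlL.le,
      integral_Ioc_eq_integral_Ioo]
    have h3 : (fun y : ℝ ↦ y ^ (N - 1) • (Ioo l L).indicator (fun y ↦ y ^ (-(N : ℝ))) y)
        = (Ioo l L).indicator fun y ↦ y⁻¹ := by
      ext y
      by_cases hy : y ∈ Ioo l L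
      · have hy0 : 0 < y := hl.trans hy.1
        rw [indicator_of_mem hy, indicator_of_mem hy, Real.rpow_neg hy0.le, Real.rpow_natCast,
          smul_eq_mul]
        obtain ⟨k, rfl⟩ := Nat.exists_eq_succ_of_ne_zero hN
        rw [Nat.succ_sub_one, Nat.succ_eq_add_one, pow_succ]
        field_simp
      · simp [hy]
    rw [h3, setIntegral_indicator measurableSet_Ioo,
      inter_eq_right.2 (Ioo_subset_Ioi_self.trans (Ioi_subset_Ioi hl.le))]
  rw [finrank_euclideanSpace_fin, h2, nsmul_eq_mul, smul_eq_mul, ← mul_assoc] at h1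
  rw [← integral_indicator hmeas]
  exact h1

/-- The Moser function as a truncated logarithm of the dual norm. -/
theorem moserFn_eq (hN : N ≠ 0) {l L : ℝ} (hl : 0 < l) (hlL : l < L) (x : Euc N) :
    moserFn N H l L x = (N * wulffVol N H) ^ (-(1 : ℝ) / N) / Real.log (L / l) ^ ((1 : ℝ) / N) *
      (Real.log L - Real.log (max l (min (dualNorm H x) L))) := by
  have hD : 0 < Real.log (L / l) := Real.log_pos ((one_lt_div hl).2 hlL)
  have hL : 0 < L := hl.trans hlL
  unfold moserFn
  split_ifs with h1 h2
  · rw [max_eq_left ((min_le_left _ _).trans h1), ← Real.log_div hL.ne' hl.ne',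
      show ((N : ℝ) - 1) / N = 1 - 1 / N by field_simp, Real.rpow_sub hD, Real.rpow_one]
    ring
  · rw [min_eq_left h2, max_eq_right (not_le.1 h1).le,
      Real.log_div hL.ne' (hl.trans (not_le.1 h1)).ne']
    ring
  · rw [min_eq_right (not_le.1 h2).le, max_eq_right hlL.le]
    ring

theorem lipschitzOnWith_log {l : ℝ} (hl : 0 < l) :
    LipschitzOnWith (l⁻¹).toNNReal Real.log (Ici l) := by
  refine LipschitzOnWith.of_le_add_mul _ fun a (ha : l ≤ a) b (hb : l ≤ b) ↦ ?_
  have hb0 := hl.trans_le hb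
  have ha0 := hl.trans_le ha
  rw [Real.coe_toNNReal _ (inv_nonneg.2 hl.le), Real.dist_eq]
  have h1 := Real.log_le_sub_one_of_pos (div_pos ha0 hb0)
  rw [Real.log_div ha0.ne' hb0.ne', div_sub_one hb0.ne'] at h1
  have h2 : (a - b) / b ≤ l⁻¹ * |a - b| := by
    rw [div_eq_inv_mul]
    calc b⁻¹ * (a - b) ≤ b⁻¹ * |a - b| :=
          mul_le_mul_of_nonneg_left (le_abs_self _) (inv_nonneg.2 hb0.le)
      _ ≤ l⁻¹ * |a - b| :=
          mul_le_mul_of_nonneg_right (inv_anti₀ hl hb) (abs_nonneg _)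
  linarith

theorem exists_lipschitzWith_moserFn (hN : N ≠ 0) (h : IsFinslerNorm N H)
    (hreg : FinslerRegular N H) {l L : ℝ} (hl : 0 < l) (hlL : l < L) :
    ∃ K : ℝ≥0, LipschitzWith K (moserFn N H l L) := by
  obtain ⟨K, hK⟩ := exists_lipschitzWith_dualNorm h hreg
  rw [funext (moserFn_eq hN hl hlL)]
  have h1 := (lipschitzOnWith_log hl).comp ((hK.min_const L).const_max l).lipschitzOnWith
    (s := univ) fun x _ ↦ mem_Ici.2 (le_max_left _ _)
  rw [lipschitzOnWith_univ] at h1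
  exact ⟨_, (lipschitzWith_smul
    ((N * wulffVol N H) ^ (-(1 : ℝ) / N) / Real.log (L / l) ^ ((1 : ℝ) / N))).comp ((LipschitzWith.const (Real.log L)).sub h1)⟩

theorem gradient_moserFn_of_annulus (hN : N ≠ 0) {l L : ℝ} (hl : 0 < l) (hlL : l < L)
    (h : IsFinslerNorm N H) (hreg : FinslerRegular N H) {x v : Euc N}
    (hx : l < dualNorm H x ∧ dualNorm H x < L) (hv : HasGradientAt (dualNorm H) v x) :
    gradient (moserFn N H l L) x =
      (-((N * wulffVol N H) ^ (-(1 : ℝ) / N) / Real.log (L / l) ^ ((1 : ℝ) / N) *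
        (dualNorm H x)⁻¹)) • v := by
  refine HasGradientAt.gradient ?_
  set A := (N * wulffVol N H) ^ (-(1 : ℝ) / N) / Real.log (L / l) ^ ((1 : ℝ) / N)
  have h1 : HasGradientAt (fun y ↦ A * (Real.log L - Real.log (dualNorm H y)))
      ((-(A * (dualNorm H x)⁻¹)) • v) x := by
    rw [hasGradientAt_iff_hasFDerivAt] at hv ⊢
    convert! ((hv.log (hl.trans hx.1).ne').const_sub (Real.log L)).const_mul A using 1
    simp [smul_smul]
  refine HasFDerivAt.congr_of_eventuallyEq h1 ?_
  filter_upwards [(continuous_dualNorm h hreg).continuousAt.eventually_mem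
    (isOpen_Ioo.mem_nhds hx)] with y hy
  rw [moserFn_eq hN hl hlL, min_eq_left hy.2.le, max_eq_right hy.1.le]

theorem gradient_moserFn_of_lt_or_gt (hN : N ≠ 0) {l L : ℝ} (hl : 0 < l) (hlL : l < L)
    (h : IsFinslerNorm N H) (hreg : FinslerRegular N H) {x : Euc N}
    (hx : dualNorm H x < l ∨ L < dualNorm H x) : gradient (moserFn N H l L) x = 0 := by
  have hcont := (continuous_dualNorm h hreg).continuousAt (x := x)
  set A := (N * wulffVol N H) ^ (-(1 : ℝ) / N) / Real.log (L / l) ^ ((1 : ℝ) / N)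
  have hev : ∃ c, moserFn N H l L =ᶠ[𝓝 x] fun _ ↦ c := by
    rcases hx with hx | hx
    · refine ⟨A * (Real.log L - Real.log l), ?_⟩
      filter_upwards [hcont.eventually_lt_const hx] with y hy
      rw [moserFn_eq hN hl hlL, max_eq_left ((min_le_left _ _).trans hy.le)]
    · refine ⟨A * (Real.log L - Real.log L), ?_⟩
      filter_upwards [hcont.eventually_const_lt hx] with y hy
      rw [moserFn_eq hN hl hlL, min_eq_right hy.le, max_eq_right hlL.le]
  obtain ⟨c, hc⟩ := hev
  rw [hc.gradient_eq, gradient_fun_const]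

theorem integral_apply_gradient_moserFn (hN : N ≠ 0) (h : IsFinslerNorm N H)
    (hreg : FinslerRegular N H) {l L : ℝ} (hl : 0 < l) (hlL : l < L) :
    (∫ x : Euc N, H (gradient (moserFn N H l L) x) ^ N) = 1 := by
  have : NeZero N := ⟨hN⟩
  have hD : 0 < Real.log (L / l) := Real.log_pos ((one_lt_div hl).2 hlL)
  have hκ : 0 < N * wulffVol N H :=
    mul_pos (Nat.cast_pos.2 (Nat.pos_of_ne_zero hN)) (wulffVol_pos h hreg)
  have hN' : (N : ℝ) ≠ 0 := Nat.cast_ne_zero.2 hN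
  set A := (N * wulffVol N H) ^ (-(1 : ℝ) / N) / Real.log (L / l) ^ ((1 : ℝ) / N) with hA
  have hA0 : 0 < A := by positivity
  have hAN : A ^ N = (N * wulffVol N H * Real.log (L / l))⁻¹ := by
    rw [hA, div_pow, ← Real.rpow_natCast, ← Real.rpow_natCast, ← Real.rpow_mul hκ.le,
      ← Real.rpow_mul hD.le, div_mul_cancel₀ _ hN', div_mul_cancel₀ _ hN', Real.rpow_neg_one,
      Real.rpow_one, mul_inv (N * wulffVol N H), div_eq_mul_inv]
  have hmeas : MeasurableSet {x : Euc N | l < dualNorm H x ∧ dualNorm H x < L} :=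
    (continuous_dualNorm h hreg).measurable measurableSet_Ioo
  obtain ⟨K, hK⟩ := exists_lipschitzWith_dualNorm h hreg
  have hae : (fun x : Euc N ↦ H (gradient (moserFn N H l L) x) ^ N) =ᵐ[volume]
      {x : Euc N | l < dualNorm H x ∧ dualNorm H x < L}.indicator
        fun x ↦ A ^ N * dualNorm H x ^ (-(N : ℝ)) := by
    filter_upwards [ae_dualNorm_ne h hreg l, ae_dualNorm_ne h hreg L,
      hK.ae_differentiableAt (μ := volume)] with x hxl hxL hdiff
    by_cases hx : l < dualNorm H x ∧ dualNorm H x < L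
    · have hpos := hl.trans hx.1
      have hx0 : x ≠ 0 := by
        rintro rfl
        exact hpos.ne' dualNorm_zero
      rw [indicator_of_mem (by exact hx),
        gradient_moserFn_of_annulus hN hl hlL h hreg hx hdiff.hasGradientAt, h.2.2.2,
        apply_gradient_dualNorm h hreg hx0 hdiff.hasGradientAt, mul_one, abs_neg,
        abs_of_pos (by positivity), mul_pow, Real.rpow_neg hpos.le, Real.rpow_natCast, inv_pow]
    · rw [indicator_of_notMem (by exact hx), gradient_moserFn_of_lt_or_gt hN hl hlL h hreg,
        h.zero, zero_pow hN]
      by_contra! hcon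
      exact hx ⟨lt_of_le_of_ne hcon.1 hxl.symm, lt_of_le_of_ne hcon.2 hxL⟩
  rw [integral_congr_ae hae, integral_indicator hmeas, integral_const_mul,
    setIntegral_annulus_dualNorm hN h hreg hl hlL, hAN]
  exact inv_mul_cancel₀ (by positivity)

end Finsler

/-- The annulus integral identity and normalization of the Finsler Moser function. -/
theorem moser_function_normalized (N : ℕ) (hN : 2 ≤ N) (H : Euc N → ℝ)
    (hnorm : IsFinslerNorm N H) (hreg : FinslerRegular N H)
    (l L : ℝ) (hl : 0 < l) (hlL : l < L) :
    (∫ x in {x : Euc N | l < dualNorm H x ∧ dualNorm H x < L},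
        dualNorm H x ^ (-(N : ℝ)))
      = N * wulffVol N H * Real.log (L / l) ∧
    (∃ K : ℝ≥0, LipschitzWith K (moserFn N H l L)) ∧
    (∫ x : Euc N, H (gradient (moserFn N H l L) x) ^ N) = 1 := by
  have hN0 : N ≠ 0 := by omega
  exact ⟨setIntegral_annulus_dualNorm hN0 hnorm hreg hl hlL,
    exists_lipschitzWith_moserFn hN0 hnorm hreg hl hlL,
    integral_apply_gradient_moserFn hN0 hnorm hreg hl hlL⟩
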